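/- arXiv:2307.12476 — 2 statements merged into one kernel-verified Lean document; each statement's English description precedes it below -/
import Mathlib

section
/- Let T(x) = x + α (mod 1 in each coordinate) be an ergodic translation of the d-dimensional torus 𝕋^d = (ℝ/ℤ)^d with Haar (Lebesgue) measure. Then every non-empty finite union of rational cubes of the form ∏_{j=1}^d [k_j/n, (k_j+1)/n] with n ≥ 1 and integers 0 ≤ k_j < n is not a coboundary for T. -/
open MeasureTheory Set
open scoped symmDiff
open Filter Topology

lemma Irrational.exists_separated_multiples {β : ℝ} (hβ : Irrational β) {ε : ℝ} (hε : 0 < ε) :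
    ∃ (n : ℕ) (η : ℝ), 0 < η ∧ η < ε ∧ 1 ≤ 2 * (n * η) ∧
      ∀ i : ℕ, 0 < i → i < n → ∀ m : ℤ, η ≤ |i * β - m| := by
  classical
  have key : ∀ ε : ℝ, 0 < ε → ∃ j : ℕ, 0 < j ∧ ∃ p : ℤ, |j * β - p| < ε := by
    intro ε hε
    obtain ⟨k, hk⟩ := exists_nat_one_div_lt hε
    obtain ⟨j, hj, -, h⟩ := Real.exists_nat_abs_mul_sub_round_le β (Nat.succ_pos k)
    refine ⟨j, hj, _, h.trans_lt (lt_of_le_of_lt ?_ hk)⟩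
    gcongr
    simp
  have hpos : ∀ j : ℕ, 0 < j → ∀ p : ℤ, 0 < |j * β - p| := by
    intro j hj p
    exact abs_pos.2 (sub_ne_zero.2 ((hβ.natCast_mul hj.ne').ne_int p))
  obtain ⟨hj0, p, hp⟩ := Nat.find_spec (key ε hε)
  have hjmin := fun i => Nat.find_min (m := i) (key ε hε)
  set j := Nat.find (key ε hε)
  have hη := hpos j hj0 p
  set η := |j * β - p| with hηdef
  obtain ⟨hn0, q, hq⟩ := Nat.find_spec (key η hη)
  have hnmin := fun i => Nat.find_min (m := i) (key η hη)
  set n := Nat.find (key η hη)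
  refine ⟨n, η, hη, hp, ?_, fun i hi hin m => ?_⟩
  · have hjn : j ≤ n := by
      by_contra! h
      exact hjmin n h ⟨hn0, q, hq.trans hp⟩
    by_contra! hlt
    have hjn' : (j : ℝ) ≤ n := by exact_mod_cast hjn
    have hj0' : (0 : ℝ) < j := by exact_mod_cast hj0
    have habs : |((n * p - j * q : ℤ) : ℝ)| < 1 := by
      have h1 : ((n * p - j * q : ℤ) : ℝ) = j * (n * β - q) - n * (j * β - p) := by
        push_cast; ring
      rw [h1]
      refine (abs_sub _ _).trans_lt ?_
      rw [abs_mul, abs_mul, Nat.abs_cast, Nat.abs_cast, ← hηdef]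
      nlinarith
    have hz : (n * p - j * q : ℤ) = 0 := by
      rw [← Int.abs_lt_one_iff]; exact_mod_cast habs
    have hz' : (n : ℝ) * p - j * q = 0 := by exact_mod_cast hz
    have h2 : (j : ℝ) * |n * β - q| = n * η := by
      rw [hηdef, ← Nat.abs_cast j, ← Nat.abs_cast n, ← abs_mul, ← abs_mul, Nat.abs_cast,
        Nat.abs_cast]
      congr 1
      linarith
    nlinarith
  · by_contra! h
    exact hnmin i hin ⟨hi, m, h⟩

lemma tendsto_measure_preimage_sub_symmDiff {G : Type*} [AddCommGroup G] [TopologicalSpace G]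
    [IsTopologicalAddGroup G] [MeasurableSpace G] [BorelSpace G] (μ : Measure G)
    [μ.IsAddRightInvariant] [μ.InnerRegularCompactLTTop] [IsFiniteMeasure μ]
    {B : Set G} (hB : MeasurableSet B) :
    Tendsto (fun a : G => μ (((fun x => x - a) ⁻¹' B) ∆ B)) (𝓝 0) (𝓝 0) := by
  let F : C(G, C(G, G)) := ContinuousMap.curry ⟨fun p : G × G => p.2 - p.1, by fun_prop⟩
  have h := tendsto_measure_symmDiff_preimage_nhds_zero (μ := μ) (ν := μ) (s := B)
    (F.continuous.tendsto 0) (.of_forall fun a => measurePreserving_sub_right μ a)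
    (measurePreserving_sub_right μ 0) hB.nullMeasurableSet (measure_ne_top _ _)
  have h0 : F 0 ⁻¹' B = B := by
    ext x; simp [F]
  rw [h0] at h
  exact h

/-- If `C` is the coboundary of `D` and the first `n` translates of `C` are disjoint, then `D` has
at least half the measure of their union. -/
lemma nsmul_measure_le_of_coboundary {G : Type*} [AddCommGroup G] [MeasurableSpace G]
    [MeasurableAdd G] [MeasurableSub G] (μ : Measure G) [μ.IsAddRightInvariant]
    {α : G} {C D : Set G} (hC : MeasurableSet C) (hCD : ∀ᵐ x ∂μ, x ∈ C ↔ ¬ (x - α ∈ D ↔ x ∈ D)) {n : ℕ}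
    (hdisj : ∀ x, ∀ i < n, ∀ j < n, x - i • α ∈ C → x - j • α ∈ C → i = j) :
    n * μ C ≤ 2 * μ D := by
  have hinv : ∀ (a : G) (E : Set G), μ {x | x - a ∈ E} = μ E := by
    intro a E
    simpa only [sub_eq_add_neg] using! measure_preimage_add_right μ (-a) E
  have hall : ∀ᵐ x ∂μ, ∀ i : ℕ, x - i • α ∈ C ↔ ¬ (x - (i + 1) • α ∈ D ↔ x - i • α ∈ D) := by
    rw [ae_all_iff]
    intro i
    filter_upwards [(measurePreserving_sub_right μ (i • α)).quasiMeasurePreserving.ae hCD] with x hx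
    rw [hx, add_smul, one_smul, sub_sub]
  have hsub : (⋃ i ∈ Finset.range n, {x | x - i • α ∈ C}) ≤ᵐ[μ]
      (D ∪ {x | x - n • α ∈ D} : Set G) := by
    filter_upwards [hall] with x hx hxU
    obtain ⟨i, hi, hiC⟩ : ∃ i < n, x - i • α ∈ C := by
      have : x ∈ (⋃ i ∈ Finset.range n, {x | x - i • α ∈ C}) := hxU
      simpa using this
    have hne : ∀ j < n, j ≠ i → (x - (j + 1) • α ∈ D ↔ x - j • α ∈ D) := by
      intro j hj hji
      by_contra h
      exact hji (hdisj x j hj i hi ((hx j).2 h) hiC)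
    have hlow : ∀ j ≤ i, (x - j • α ∈ D ↔ x ∈ D) := by
      intro j
      induction j with
      | zero => simp
      | succ j ih => intro hj; rw [hne j (by omega) (by omega), ih (by omega)]
    have hhigh : ∀ k, i + 1 + k ≤ n → (x - (i + 1 + k) • α ∈ D ↔ x - (i + 1) • α ∈ D) := by
      intro k
      induction k with
      | zero => simp
      | succ k ih =>
        intro hk
        rw [← add_assoc, hne (i + 1 + k) (by omega) (by omega), ih (by omega)]
    have h1 := (hx i).1 hiC
    have h2 := hlow i le_rfl
    have h3 := hhigh (n - (i + 1)) (by omega)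
    rw [Nat.add_sub_cancel' hi] at h3
    change x ∈ D ∨ x - n • α ∈ D
    tauto
  calc n * μ C = μ (⋃ i ∈ Finset.range n, {x | x - i • α ∈ C}) := by
        rw [measure_biUnion_finset]
        · simp [hinv]
        · intro i hi j hj hij
          refine Set.disjoint_left.2 fun x h1 h2 => hij ?_
          exact hdisj x i (by simpa using hi) j (by simpa using hj) h1 h2
        · intro i _
          exact (measurable_sub_const _) hC
    _ ≤ μ (D ∪ {x | x - n • α ∈ D}) := measure_mono_ae hsub
    _ ≤ μ D + μ {x | x - n • α ∈ D} := measure_union_le _ _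
    _ = 2 * μ D := by rw [hinv, two_mul]

/-- The coordinate in `ZMod N` of the arc `[k/N, (k+1)/N)` containing `x`. -/
noncomputable def gridIndex (N : ℕ) (x : AddCircle (1 : ℝ)) : ZMod N :=
  (⌊(N : ℝ) * (AddCircle.equivIco 1 0 x : ℝ)⌋ : ℤ)

lemma gridIndex_coe (N : ℕ) (t : ℝ) :
    gridIndex N (t : AddCircle (1 : ℝ)) = ((⌊(N : ℝ) * t⌋ : ℤ) : ZMod N) := by
  have h : (N : ℝ) * t = N * Int.fract t + ((N * ⌊t⌋ : ℤ) : ℝ) := by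
    push_cast
    rw [← mul_add, Int.fract_add_floor]
  rw [gridIndex, AddCircle.coe_equivIco_mk_apply, h, Int.floor_add_intCast]
  simp

lemma measurableSet_gridIndex {d N : ℕ} (S : Set (Fin d → ZMod N)) :
    MeasurableSet {x : Fin d → AddCircle (1 : ℝ) | (fun j => gridIndex N (x j)) ∈ S} := by
  have hm : Measurable fun (x : Fin d → AddCircle (1 : ℝ)) (j : Fin d) =>
      ⌊(N : ℝ) * (AddCircle.equivIco 1 0 (x j) : ℝ)⌋ := by
    refine measurable_pi_lambda _ fun j => ?_
    refine Int.measurable_floor.comp (Measurable.const_mul ?_ _)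
    exact measurable_subtype_coe.comp
      ((AddCircle.measurableEquivIco 1 0).measurable.comp (measurable_pi_apply j))
  exact hm (Set.to_countable {l : Fin d → ℤ | (fun j => ((l j : ℤ) : ZMod N)) ∈ S}).measurableSet

lemma UnitAddCircle.exists_coe_eq_of_mem_closedBall {c r : ℝ} {x : AddCircle (1 : ℝ)}
    (hx : x ∈ Metric.closedBall (c : AddCircle (1 : ℝ)) r) :
    ∃ t : ℝ, (t : AddCircle (1 : ℝ)) = x ∧ |t - c| ≤ r := by
  obtain ⟨t, rfl⟩ := QuotientAddGroup.mk_surjective x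
  rw [mem_closedBall_iff_norm, ← AddCircle.coe_sub, UnitAddCircle.norm_eq] at hx
  refine ⟨t - round (t - c), ?_, ?_⟩
  · rw [AddCircle.coe_sub, sub_eq_self]
    exact (AddCircle.coe_eq_zero_iff 1).2 ⟨round (t - c), by simp⟩
  · rwa [sub_right_comm]

lemma UnitAddCircle.coe_eq_coe_iff {s t : ℝ} :
    (s : AddCircle (1 : ℝ)) = t ↔ ∃ m : ℤ, s - t = m := by
  rw [← sub_eq_zero, ← AddCircle.coe_sub, AddCircle.coe_eq_zero_iff]
  simp [eq_comm]

lemma exists_mem_add_single_notMem {d N : ℕ} [NeZero N] {S : Set (Fin d → ZMod N)} (hS : S.Nonempty)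
    (hS' : S ≠ univ) : ∃ κ ∈ S, ∃ i, κ + Pi.single i 1 ∉ S := by
  by_contra! h
  apply hS'
  let M : AddSubmonoid (Fin d → ZMod N) :=
    { carrier := {v | ∀ κ ∈ S, κ + v ∈ S}
      zero_mem' := by simp
      add_mem' := fun {a b} ha hb κ hκ => by
        rw [← add_assoc]; exact hb _ (ha _ hκ) }
  have h1 : ∀ v, v ∈ M := by
    intro v
    rw [← Finset.univ_sum_single v]
    refine sum_mem fun i _ => ?_
    have : (Pi.single i (v i) : Fin d → ZMod N) = (v i).val • Pi.single i (1 : ZMod N) := by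
      rw [← Pi.single_smul]; simp
    rw [this]
    exact nsmul_mem (show Pi.single i 1 ∈ M from fun κ hκ => h κ hκ i) _
  obtain ⟨κ, hκ⟩ := hS
  refine eq_univ_of_forall fun v => ?_
  simpa using h1 (v - κ) κ hκ

instance isProbabilityMeasure_addCircle_one :
    IsProbabilityMeasure (volume : Measure (AddCircle (1 : ℝ))) := ⟨by simp⟩

lemma irrational_of_ergodic {d : ℕ} {α : Fin d → AddCircle (1 : ℝ)}
    (hT : Ergodic (fun x : Fin d → AddCircle (1 : ℝ) => x + α) volume) (i : Fin d) {a : ℝ}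
    (ha : (a : AddCircle (1 : ℝ)) = α i) : Irrational a := by
  have hi : Ergodic (fun y : AddCircle (1 : ℝ) => y + α i) volume :=
    MeasurePreserving.ergodic_of_ergodic_semiconj
      (measurePreserving_eval (fun _ : Fin d => (volume : Measure (AddCircle (1 : ℝ)))) i) hT
      (measurable_add_const _) fun _ => rfl
  rw [AddCircle.ergodic_add_right, ← ha] at hi
  rintro ⟨q, rfl⟩
  rw [addOrderOf_eq_zero_iff'] at hi
  refine hi q.den q.den_pos ?_
  rw [← AddCircle.coe_nsmul, AddCircle.coe_eq_zero_iff]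
  refine ⟨q.num, ?_⟩
  have := Rat.den_mul_eq_num q
  simp only [nsmul_eq_mul, zsmul_eq_mul, mul_one]
  exact_mod_cast this.symm

lemma exists_coe_eq_of_gridIndex_ne {N : ℕ} [NeZero N] {δ : ℝ} (hδ : 0 < δ)
    {x : AddCircle (1 : ℝ)} (hx : ¬ gridIndex N (x - (δ : AddCircle (1 : ℝ))) = gridIndex N x) :
    ∃ (m : ℤ) (s : ℝ), 0 ≤ s ∧ s < δ ∧ ((m / N + s : ℝ) : AddCircle (1 : ℝ)) = x := by
  obtain ⟨t, rfl⟩ := QuotientAddGroup.mk_surjective x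
  rw [← AddCircle.coe_sub, gridIndex_coe, gridIndex_coe] at hx
  have hN : (0 : ℝ) < N := by exact_mod_cast Nat.pos_of_ne_zero (NeZero.ne N)
  have hne : ⌊(N : ℝ) * (t - δ)⌋ ≠ ⌊(N : ℝ) * t⌋ := fun h => hx (by rw [h])
  have hlt : (N : ℝ) * (t - δ) < ⌊(N : ℝ) * t⌋ := by
    by_contra! h
    refine hne (le_antisymm (Int.floor_le_floor (by nlinarith)) (Int.le_floor.2 h))
  have hle := Int.floor_le ((N : ℝ) * t)
  refine ⟨⌊(N : ℝ) * t⌋, t - ⌊(N : ℝ) * t⌋ / N, ?_, ?_, by simp⟩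
  · rw [sub_nonneg, div_le_iff₀ hN]; linarith
  · rw [sub_lt_comm, lt_div_iff₀ hN]; linarith

lemma le_volume_gridIndex_jump {d N : ℕ} [NeZero N] {S : Set (Fin d → ZMod N)} {κ : Fin d → ZMod N}
    (hκ : κ ∈ S) {i : Fin d} (hi : κ + Pi.single i 1 ∉ S) {δ : ℝ} (hδ : 0 < δ) (hδN : N * δ < 1) :
    ENNReal.ofReal (δ / 2) * ENNReal.ofReal (1 / (2 * N)) ^ d ≤
      volume {x : Fin d → AddCircle (1 : ℝ) |
        ¬ ((fun j => gridIndex N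
            ((x - Pi.single i (δ : AddCircle (1 : ℝ)) : Fin d → AddCircle (1 : ℝ)) j)) ∈ S ↔
          (fun j => gridIndex N (x j)) ∈ S)} := by
  have hN : (1 : ℝ) ≤ N := by exact_mod_cast Nat.pos_of_ne_zero (NeZero.ne N)
  have hN0 : (0 : ℝ) < N := by linarith
  have hδ1 : δ < 1 := by nlinarith
  let box : Fin d → Set (AddCircle (1 : ℝ)) := fun j =>
    if j = i then Metric.closedBall ((((κ i).val + 1) / N + δ / 2 : ℝ) : AddCircle (1 : ℝ)) (δ / 4)
    else Metric.closedBall ((((κ j).val + 1 / 2) / N : ℝ) : AddCircle (1 : ℝ)) (1 / (4 * N))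
  have hsmall : 1 / (2 * (N : ℝ)) ≤ 1 := by
    rw [div_le_one (by positivity)]; linarith
  have hvol : ENNReal.ofReal (δ / 2) * ENNReal.ofReal (1 / (2 * N)) ^ d ≤
      volume (Set.pi univ box) := by
    rw [volume_pi_pi]
    calc ENNReal.ofReal (δ / 2) * ENNReal.ofReal (1 / (2 * N)) ^ d
        = ∏ j : Fin d, (if j = i then ENNReal.ofReal (δ / 2) else 1) *
            ENNReal.ofReal (1 / (2 * N)) := by
          rw [Finset.prod_mul_distrib]; simp
      _ ≤ _ := by
          refine Finset.prod_le_prod' fun j _ => ?_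
          by_cases hj : j = i
          · simp only [box, hj, if_true, AddCircle.volume_closedBall]
            rw [min_eq_right (by linarith), show 2 * (δ / 4) = δ / 2 by ring]
            exact mul_le_of_le_one_right' (by simpa using ENNReal.ofReal_le_ofReal hsmall)
          · simp only [box, hj, if_false, AddCircle.volume_closedBall, one_mul]
            have h2 : 2 * (1 / (4 * (N : ℝ))) = 1 / (2 * N) := by field_simp; norm_num
            rw [h2, min_eq_right hsmall]
  refine hvol.trans (measure_mono fun x hx => ?_)
  have hother : ∀ j, j ≠ i → gridIndex N (x j) = κ j := by
    intro j hj
    have hxj := hx j (mem_univ j)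
    simp only [box, hj, if_false] at hxj
    obtain ⟨t, ht, htc⟩ := UnitAddCircle.exists_coe_eq_of_mem_closedBall hxj
    have hfl : ⌊(N : ℝ) * t⌋ = (κ j).val := by
      have h1 : |N * t - ((κ j).val + 1 / 2)| ≤ 1 / 4 := by
        calc |N * t - ((κ j).val + 1 / 2)| = N * |t - ((κ j).val + 1 / 2) / N| := by
              rw [← abs_of_pos hN0, ← abs_mul, abs_of_pos hN0]
              congr 1; field_simp
          _ ≤ N * (1 / (4 * N)) := by gcongr
          _ = 1 / 4 := by field_simp
      rw [abs_le] at h1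
      rw [Int.floor_eq_iff]
      push_cast
      constructor <;> linarith
    rw [← ht, gridIndex_coe, hfl]
    simp
  have hxi := hx i (mem_univ i)
  simp only [box, if_true] at hxi
  obtain ⟨t, ht, htc⟩ := UnitAddCircle.exists_coe_eq_of_mem_closedBall hxi
  have hNt : N * t = ((κ i).val + 1) + N * (t - ((κ i).val + 1) / N) := by field_simp; ring
  rw [abs_le] at htc
  have hlo : N * (δ / 4) ≤ N * (t - ((κ i).val + 1) / N) := by gcongr; linarith
  have hhi : N * (t - ((κ i).val + 1) / N) ≤ N * (3 * δ / 4) := by gcongr; linarith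
  have hNδ : 0 < N * δ := by positivity
  have hfl1 : ⌊(N : ℝ) * t⌋ = (κ i).val + 1 := by
    rw [Int.floor_eq_iff]
    push_cast
    constructor <;> linarith
  have hfl2 : ⌊(N : ℝ) * (t - δ)⌋ = (κ i).val := by
    rw [Int.floor_eq_iff, mul_sub]
    push_cast
    constructor <;> linarith
  have hcell : (fun j => gridIndex N (x j)) = κ + Pi.single i 1 := by
    funext j
    by_cases hj : j = i
    · subst hj
      rw [← ht, gridIndex_coe, hfl1]
      simp
    · rw [hother j hj]; simp [hj]
  have hcell' : (fun j => gridIndex N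
      ((x - Pi.single i (δ : AddCircle (1 : ℝ)) : Fin d → AddCircle (1 : ℝ)) j)) = κ := by
    funext j
    by_cases hj : j = i
    · subst hj
      rw [Pi.sub_apply, Pi.single_eq_same, ← ht, ← AddCircle.coe_sub, gridIndex_coe, hfl2]
      simp
    · rw [Pi.sub_apply, Pi.single_eq_of_ne hj, sub_zero, hother j hj]
  rw [mem_ofPred_eq, hcell, hcell']
  tauto

lemma not_ae_coboundary_univ {d : ℕ} {α : Fin d → AddCircle (1 : ℝ)}
    (hT : Ergodic (fun x : Fin d → AddCircle (1 : ℝ) => x + α) volume)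
    {B : Set (Fin d → AddCircle (1 : ℝ))} (hB : MeasurableSet B) :
    ¬ ∀ᵐ x, ¬ (x - α ∈ B ↔ x ∈ B) := by
  intro h
  obtain ⟨θ, rfl⟩ : ∃ θ : Fin d → AddCircle (1 : ℝ), θ + θ = α := by
    choose a ha using fun i => QuotientAddGroup.mk_surjective (α i)
    refine ⟨fun i => ((a i / 2 : ℝ) : AddCircle (1 : ℝ)), funext fun i => ?_⟩
    rw [Pi.add_apply, ← AddCircle.coe_add, add_halves]
    exact ha i
  let E : Set (Fin d → AddCircle (1 : ℝ)) := {x | x - θ ∈ B ↔ x ∈ B}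
  have hE : MeasurableSet E := by
    have h1 : MeasurableSet {x : Fin d → AddCircle (1 : ℝ) | x - θ ∈ B} :=
      (measurable_sub_const θ) hB
    exact h1.iff hB
  have hinv : (fun x => x + (θ + θ)) ⁻¹' E =ᵐ[volume] E := by
    have h1 := (measurePreserving_add_right volume (θ + θ)).quasiMeasurePreserving.ae h
    have h2 := (measurePreserving_sub_right volume θ).quasiMeasurePreserving.ae h1
    filter_upwards [h1, h2] with x hx1 hx2
    apply propext
    rw [add_sub_cancel_right] at hx1 hx2
    rw [sub_add_eq_add_sub] at hx2
    change (x + (θ + θ) - θ ∈ B ↔ x + (θ + θ) ∈ B) ↔ (x - θ ∈ B ↔ x ∈ B)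
    tauto
  have hshift : ∀ {P : (Fin d → AddCircle (1 : ℝ)) → Prop}, (∀ᵐ x, P x) → ∀ᵐ x, P (x - θ) :=
    fun hP => (measurePreserving_sub_right volume θ).quasiMeasurePreserving.ae hP
  suffices h_false : ∀ᵐ x : Fin d → AddCircle (1 : ℝ), False by
    exact h_false.exists.elim fun _ h => h
  rcases hT.quasiErgodic.ae_mem_or_ae_notMem₀ hE.nullMeasurableSet hinv with hc | hc
  all_goals
    filter_upwards [h, hc, hshift hc] with x hx h1 h2
    simp only [E, mem_ofPred_eq] at h1 h2
    rw [sub_sub] at h2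
    tauto

lemma not_iff_not_iff_not_iff_xor (p q r s : Prop) :
    (¬ (¬ (p ↔ q) ↔ ¬ (r ↔ s))) ↔ ¬ (p ∧ ¬ r ∨ r ∧ ¬ p ↔ q ∧ ¬ s ∨ s ∧ ¬ q) := by
  by_cases p <;> by_cases q <;> by_cases r <;> by_cases s <;> simp [*]

lemma gridIndex_union_not_coboundary {d N : ℕ} [NeZero N] {α : Fin d → AddCircle (1 : ℝ)}
    (hT : Ergodic (fun x : Fin d → AddCircle (1 : ℝ) => x + α) volume)
    {S : Set (Fin d → ZMod N)} (hS : S.Nonempty)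
    {B : Set (Fin d → AddCircle (1 : ℝ))} (hB : MeasurableSet B) :
    ¬ ∀ᵐ x, ((fun j => gridIndex N (x j)) ∈ S ↔ ¬ (x - α ∈ B ↔ x ∈ B)) := by
  intro hcob
  by_cases hSu : S = univ
  · exact not_ae_coboundary_univ hT hB (by simpa [hSu] using hcob)
  obtain ⟨κ, hκ, i, hi⟩ := exists_mem_add_single_notMem hS hSu
  obtain ⟨a, ha⟩ : ∃ a : ℝ, (a : AddCircle (1 : ℝ)) = α i :=
    QuotientAddGroup.mk_surjective (α i)
  have hirr : Irrational (N * a) := (irrational_of_ergodic hT i ha).natCast_mul (NeZero.ne N)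
  have hN : (1 : ℝ) ≤ N := by exact_mod_cast Nat.pos_of_ne_zero (NeZero.ne N)
  have hN0 : (0 : ℝ) < N := by linarith
  let e : ℝ → (Fin d → AddCircle (1 : ℝ)) := fun δ => Pi.single i (δ : AddCircle (1 : ℝ))
  let c : ENNReal := ENNReal.ofReal (1 / (4 * N)) * ENNReal.ofReal (1 / (2 * N)) ^ d
  have hc : 0 < c := by
    refine ENNReal.mul_pos ?_ (pow_ne_zero _ ?_) <;>
    · rw [Ne, ENNReal.ofReal_eq_zero, not_le]; positivity
  have hlim : Tendsto (fun δ : ℝ => 2 * volume (((fun x => x - e δ) ⁻¹' B) ∆ B)) (𝓝 0) (𝓝 0) := by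
    have he : Tendsto e (𝓝 0) (𝓝 0) := by
      have hcont : Continuous e :=
        (continuous_single i).comp (AddCircle.continuous_mk' 1)
      simpa [e] using hcont.tendsto 0
    simpa using ENNReal.Tendsto.const_mul
      ((tendsto_measure_preimage_sub_symmDiff volume hB).comp he) (Or.inr (by simp))
  obtain ⟨ε, hε, hball⟩ := Metric.eventually_nhds_iff.1 (hlim.eventually_lt_const hc)
  obtain ⟨n, η, hη, hηε, hnη, hsep⟩ := hirr.exists_separated_multiples (lt_min hε one_pos)
  rw [lt_min_iff] at hηε
  have hδ : 0 < η / N := by positivity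
  have hδN : N * (η / N) = η := by field_simp
  have hδη : η / N ≤ η := div_le_self hη.le hN
  have hsmall := hball (y := η / N) (by
    rw [Real.dist_eq, sub_zero, abs_of_pos hδ]; linarith)
  refine absurd hsmall (not_lt.2 ?_)
  let C : Set (Fin d → AddCircle (1 : ℝ)) := {x |
    ¬ ((fun j => gridIndex N ((x - e (η / N)) j)) ∈ S ↔ (fun j => gridIndex N (x j)) ∈ S)}
  have hCm : MeasurableSet C :=
    (((measurable_sub_const (e (η / N))) (measurableSet_gridIndex S)).iff
      (measurableSet_gridIndex S)).compl
  have hCvol := le_volume_gridIndex_jump hκ hi hδ (by rw [hδN]; exact hηε.2)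
  have hjump : ∀ x ∈ C, ∃ (m : ℤ) (s : ℝ), 0 ≤ s ∧ s < η / N ∧
      ((m / N + s : ℝ) : AddCircle (1 : ℝ)) = x i := by
    intro x hx
    apply exists_coe_eq_of_gridIndex_ne hδ
    intro heq
    apply hx
    have : (fun j => gridIndex N ((x - e (η / N)) j)) = fun j => gridIndex N (x j) := by
      funext j
      by_cases hj : j = i
      · subst hj; simpa [e] using heq
      · simp [e, hj]
    rw [this]
  have hlt : ∀ x : Fin d → AddCircle (1 : ℝ), ∀ j < n, ∀ k < j,
      x - j • α ∈ C → x - k • α ∈ C → False := by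
    intro x j hj k hk h1 h2
    obtain ⟨m, s, hs0, hs, hms⟩ := hjump _ h1
    obtain ⟨m', s', hs0', hs', hms'⟩ := hjump _ h2
    have hdiff : ((m' / N + s' - (m / N + s) : ℝ) : AddCircle (1 : ℝ)) = (((j - k : ℕ) * a : ℝ)) := by
      rw [AddCircle.coe_sub, hms, hms', ← nsmul_eq_mul, AddCircle.coe_nsmul, ha, sub_nsmul _ hk.le]
      simp only [Pi.sub_apply, Pi.smul_apply]
      abel
    obtain ⟨z, hz⟩ := UnitAddCircle.coe_eq_coe_iff.1 hdiff
    have hsp := hsep (j - k) (by omega) (by omega) (m' - m - N * z)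
    have h3 : ((j - k : ℕ) : ℝ) * (N * a) - ((m' - m - N * z : ℤ) : ℝ) = N * (s' - s) := by
      have : ((j - k : ℕ) : ℝ) * a = (m' / N + s' - (m / N + s)) - z := by linarith
      calc ((j - k : ℕ) : ℝ) * (N * a) - ((m' - m - N * z : ℤ) : ℝ)
          = N * (((j - k : ℕ) : ℝ) * a) - ((m' - m - N * z : ℤ) : ℝ) := by ring
        _ = _ := by
          rw [this]; push_cast; field_simp; ring
    rw [h3, abs_mul, abs_of_pos hN0] at hsp
    have : |s' - s| < η / N := abs_sub_lt_of_nonneg_of_lt hs0' hs' hs0 hs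
    have := (mul_lt_mul_iff_right₀ hN0).2 this
    linarith
  have hcobC : ∀ᵐ x, x ∈ C ↔ ¬ (x - α ∈ ((fun x => x - e (η / N)) ⁻¹' B) ∆ B ↔
      x ∈ ((fun x => x - e (η / N)) ⁻¹' B) ∆ B) := by
    have h2 := (measurePreserving_sub_right volume (e (η / N))).quasiMeasurePreserving.ae hcob
    filter_upwards [hcob, h2] with x hx1 hx2
    rw [mem_symmDiff, mem_symmDiff, mem_preimage, mem_preimage, sub_right_comm x α]
    change ¬ _ ↔ _
    rw [hx1, hx2]
    exact not_iff_not_iff_not_iff_xor _ _ _ _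
  calc c ≤ n * volume C := by
        refine le_trans ?_ (mul_le_mul_right hCvol _)
        rw [← mul_assoc, ← ENNReal.ofReal_natCast n, ← ENNReal.ofReal_mul (by positivity)]
        refine mul_le_mul_left (ENNReal.ofReal_le_ofReal ?_) _
        have : n * (η / N / 2) = (2 * (n * η)) * (1 / (4 * N)) := by field_simp; norm_num
        rw [this]
        exact le_mul_of_one_le_left (by positivity) hnη
    _ ≤ _ := nsmul_measure_le_of_coboundary volume hCm hcobC (by
        intro x j hj k hk h1 h2
        rcases lt_trichotomy j k with h | h | h
        · exact (hlt x k hk j h h2 h1).elim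
        · exact h
        · exact (hlt x j hj k h h1 h2).elim)

lemma ae_apply_ne {d : ℕ} (j : Fin d) (c : AddCircle (1 : ℝ)) :
    ∀ᵐ x : Fin d → AddCircle (1 : ℝ), x j ≠ c := by
  have hc : volume {c} = 0 := by
    rw [← Metric.closedBall_zero, AddCircle.volume_closedBall]
    simp
  have hmp := measurePreserving_eval (fun _ : Fin d => (volume : Measure (AddCircle (1 : ℝ)))) j
  have h := hmp.measure_preimage (measurableSet_singleton c).nullMeasurableSet
  rw [hc] at h
  exact measure_eq_zero_iff_ae_notMem.1 h

lemma ae_mem_iUnion_cube_iff {d N : ℕ} [NeZero N] (s : Finset (ℕ × (Fin d → ℕ)))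
    (hs : ∀ p ∈ s, p.1 ∣ N) :
    ∀ᵐ x : Fin d → AddCircle (1 : ℝ),
      x ∈ (⋃ p ∈ s, Set.univ.pi (fun j : Fin d =>
        (fun r : ℝ => (r : AddCircle (1 : ℝ))) ''
          Set.Icc ((p.2 j : ℝ) / (p.1 : ℝ)) (((p.2 j : ℝ) + 1) / (p.1 : ℝ)))) ↔
      (fun j => gridIndex N (x j)) ∈ {κ : Fin d → ZMod N | ∃ p ∈ s, ∀ j, ∃ l : ℤ,
        (p.2 j * (N / p.1 : ℕ) : ℤ) ≤ l ∧ l < (p.2 j + 1) * (N / p.1 : ℕ) ∧ (l : ZMod N) = κ j} := by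
  have hN0 : (0 : ℝ) < N := by exact_mod_cast Nat.pos_of_ne_zero (NeZero.ne N)
  have hgen : ∀ᵐ x : Fin d → AddCircle (1 : ℝ), ∀ j, ∀ m : ℤ,
      x j ≠ ((m / N : ℝ) : AddCircle (1 : ℝ)) :=
    ae_all_iff.2 fun j => ae_all_iff.2 fun m => ae_apply_ne j _
  filter_upwards [hgen] with x hx
  simp only [mem_iUnion, exists_prop, mem_univ_pi]
  refine exists_congr fun p => and_congr_right fun hp => forall_congr' fun j => ?_
  obtain ⟨M, hM⟩ := hs p hp
  have hp0 : 0 < p.1 := Nat.pos_of_ne_zero fun h => NeZero.ne N (by rw [hM, h, zero_mul])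
  have hp0' : (0 : ℝ) < p.1 := by exact_mod_cast hp0
  have hdiv : N / p.1 = M := by rw [hM]; exact Nat.mul_div_cancel_left _ hp0
  have hMR : (N : ℝ) = p.1 * M := by exact_mod_cast hM
  have hM0 : (0 : ℝ) < M := by
    rw [hMR] at hN0; exact pos_of_mul_pos_right hN0 hp0'.le
  rw [hdiv]
  have hIcc : ∀ r : ℝ, r ∈ Icc ((p.2 j : ℝ) / p.1) ((p.2 j + 1) / p.1) ↔
      (p.2 j * M : ℝ) ≤ N * r ∧ N * r ≤ (p.2 j + 1) * M := by
    intro r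
    rw [mem_Icc, div_le_iff₀ hp0', le_div_iff₀ hp0', hMR]
    constructor
    · rintro ⟨h1, h2⟩; constructor <;> nlinarith
    · rintro ⟨h1, h2⟩; constructor <;> nlinarith
  constructor
  · rintro ⟨r, hr, hrx⟩
    rw [hIcc] at hr
    refine ⟨⌊(N : ℝ) * r⌋, ?_, ?_, ?_⟩
    · rw [Int.le_floor]; push_cast; exact hr.1
    · rw [Int.floor_lt]
      push_cast
      refine lt_of_le_of_ne hr.2 fun heq => hx j ((p.2 j + 1) * M) ?_
      rw [← hrx]
      congr 1
      push_cast
      rw [eq_div_iff hN0.ne']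
      linarith
    · rw [← hrx, gridIndex_coe]
  · rintro ⟨l, hl1, hl2, hl⟩
    obtain ⟨t, ht⟩ : ∃ t : ℝ, (t : AddCircle (1 : ℝ)) = x j :=
      QuotientAddGroup.mk_surjective (x j)
    rw [← ht, gridIndex_coe, ZMod.intCast_eq_intCast_iff_dvd_sub] at hl
    obtain ⟨z, hz⟩ := hl
    have hfl : ⌊(N : ℝ) * (t - z)⌋ = l := by
      have : (N : ℝ) * (t - z) = N * t - ((N * z : ℤ) : ℝ) := by push_cast; ring
      rw [this, Int.floor_sub_intCast]; omega
    rw [Int.floor_eq_iff] at hfl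
    refine ⟨t - z, (hIcc _).2 ⟨?_, ?_⟩, ?_⟩
    · have : (p.2 j * M : ℝ) ≤ l := by exact_mod_cast hl1
      linarith
    · have : (l + 1 : ℝ) ≤ (p.2 j + 1) * M := by exact_mod_cast hl2
      linarith
    · rw [← ht]
      exact UnitAddCircle.coe_eq_coe_iff.2 ⟨-z, by push_cast; ring⟩

/-- Let `T(x) = x + α` be an ergodic translation of the `d`-dimensional
torus `𝕋^d = (ℝ/ℤ)^d` with Haar (Lebesgue) measure.  Then every non-empty finite union of
rational cubes `∏_j [kⱼ/n, (kⱼ+1)/n]` (with `n ≥ 1` and `0 ≤ kⱼ < n`) is not a coboundary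
for `T`. -/
theorem rational_cube_union_not_coboundary
    (d : ℕ) (α : Fin d → AddCircle (1 : ℝ))
    (hT : Ergodic (fun x : Fin d → AddCircle (1 : ℝ) => x + α) volume)
    (s : Finset (ℕ × (Fin d → ℕ))) (hs : s.Nonempty)
    (hvalid : ∀ p ∈ s, 1 ≤ p.1 ∧ ∀ j : Fin d, p.2 j < p.1) :
    ¬ ∃ B : Set (Fin d → AddCircle (1 : ℝ)), MeasurableSet B ∧
        (((fun x => x + α) '' B) ∆ B : Set (Fin d → AddCircle (1 : ℝ))) =ᵐ[volume]
          ⋃ p ∈ s, Set.univ.pi (fun j : Fin d =>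
            (fun r : ℝ => (r : AddCircle (1 : ℝ))) ''
              Set.Icc ((p.2 j : ℝ) / (p.1 : ℝ)) (((p.2 j : ℝ) + 1) / (p.1 : ℝ))) := by
  rintro ⟨B, hB, hcob⟩
  let N := ∏ p ∈ s, p.1
  have hdvd : ∀ p ∈ s, p.1 ∣ N := fun p hp => Finset.dvd_prod_of_mem _ hp
  have hN : N ≠ 0 := Finset.prod_ne_zero_iff.2 fun p hp => by have := (hvalid p hp).1; omega
  have : NeZero N := ⟨hN⟩
  refine gridIndex_union_not_coboundary hT (N := N) (S := {κ | ∃ p ∈ s, ∀ j, ∃ l : ℤ,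
    (p.2 j * (N / p.1 : ℕ) : ℤ) ≤ l ∧ l < (p.2 j + 1) * (N / p.1 : ℕ) ∧ (l : ZMod N) = κ j})
    ?_ hB ?_
  · obtain ⟨p, hp⟩ := hs
    have hpos : 0 < N / p.1 :=
      Nat.div_pos (Nat.le_of_dvd (Nat.pos_of_ne_zero hN) (hdvd p hp)) (hvalid p hp).1
    refine ⟨fun j => ((p.2 j * (N / p.1 : ℕ) : ℤ) : ZMod N), p, hp, fun j => ⟨_, le_rfl, ?_, rfl⟩⟩
    rw [add_mul, one_mul]
    omega
  · filter_upwards [hcob.mem_iff, ae_mem_iUnion_cube_iff s hdvd] with x h1 h2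
    rw [← h2, ← h1, mem_symmDiff, image_add_right, mem_preimage, ← sub_eq_add_neg]
    tauto
end

section
/- Let T be a cyclic permutation of a finite set X with n ≥ 1 elements (a single n-cycle), and let A ⊆ X. Consider the skew product permutation S of X × ℤ₂ defined by S(x,s) = (T(x), s + 1_A(x)). Then S is a single cycle of length 2n if and only if |A| is odd; if |A| is even, S has exactly two cycles, each of length n. -/
/-- Powers of a skew product act on the fibre by Birkhoff sums of the cocycle. -/
theorem skew_product_pow_apply {X G : Type*} [AddCommMonoid G] (T : Equiv.Perm X) (f : X → G)
    (S : Equiv.Perm (X × G)) (hS : ∀ p, S p = (T p.1, p.2 + f p.1)) (k : ℕ) (p : X × G) :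
    (S ^ k) p = ((T ^ k) p.1, p.2 + ∑ i ∈ Finset.range k, f ((T ^ i) p.1)) := by
  induction k with
  | zero => simp
  | succ k ih =>
    rw [pow_succ', Equiv.Perm.mul_apply, ih, hS, pow_succ', Finset.sum_range_succ, add_assoc]
    rfl

theorem skew_product_zpow_apply_fst {X G : Type*} [AddCommMonoid G] (T : Equiv.Perm X)
    (f : X → G) (S : Equiv.Perm (X × G)) (hS : ∀ p, S p = (T p.1, p.2 + f p.1)) (k : ℤ)
    (p : X × G) : ((S ^ k) p).1 = (T ^ k) p.1 := by
  cases k with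
  | ofNat k => simp [skew_product_pow_apply T f S hS]
  | negSucc k =>
    obtain ⟨q, rfl⟩ := (S ^ (k + 1)).surjective p
    rw [zpow_negSucc, zpow_negSucc, ← Equiv.Perm.mul_apply, inv_mul_cancel, Equiv.Perm.one_apply,
      Equiv.Perm.eq_inv_iff_eq, skew_product_pow_apply T f S hS]

theorem Equiv.Perm.IsCycleOn.sum_range_card {X M : Type*} [AddCommMonoid M] {T : Equiv.Perm X}
    {s : Finset X} (hT : T.IsCycleOn s) {a : X} (ha : a ∈ s) (f : X → M) :
    ∑ i ∈ Finset.range s.card, f ((T ^ i) a) = ∑ x ∈ s, f x := by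
  refine Finset.sum_nbij (fun i => (T ^ i) a) ?_ ?_ ?_ (fun _ _ => rfl)
  · exact fun i _ => (hT.1.perm_pow i).mapsTo ha
  · intro i hi j hj hij
    simp only [Finset.coe_range, Set.mem_Iio] at hi hj
    exact ((hT.pow_apply_eq_pow_apply ha).1 hij).eq_of_lt_of_lt hi hj
  · intro y hy
    obtain ⟨i, hi, rfl⟩ := hT.exists_pow_eq ha hy
    exact ⟨i, by simpa using hi, rfl⟩

/-- Let `T` be a permutation of a finite set `X` with `n ≥ 1` elements
consisting of a single `n`-cycle, let `A ⊆ X`, and let `S` be the skew-product permutation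
of `X × ℤ₂` given by `S(x, s) = (T x, s + 1_A(x))`.  Then `S` is a single cycle of length
`2n` if and only if `|A|` is odd; and if `|A|` is even, `S` has exactly two cycles, each of
length `n`. -/
theorem skew_product_of_cycle_cycles
    {X : Type*} [Finite X] (n : ℕ) (hn : 1 ≤ n) (hcard : Nat.card X = n)
    (T : Equiv.Perm X) (hT : ∀ x y : X, T.SameCycle x y)
    (A : Set X) (S : Equiv.Perm (X × ZMod 2))
    (hS : ∀ p : X × ZMod 2, S p = (T p.1, p.2 + A.indicator 1 p.1)) :
    (((∀ p q : X × ZMod 2, S.SameCycle p q) ∧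
        ∀ p : X × ZMod 2, Nat.card {q : X × ZMod 2 | S.SameCycle p q} = 2 * n) ↔
      Odd (Nat.card A)) ∧
    (Even (Nat.card A) →
      Nat.card (Quotient (Equiv.Perm.SameCycle.setoid S)) = 2 ∧
        ∀ p : X × ZMod 2, Nat.card {q : X × ZMod 2 | S.SameCycle p q} = n) := by
  classical
  have := Fintype.ofFinite X
  have hX : Nonempty X := (Nat.card_pos_iff.1 (hcard ▸ hn)).1
  have hcyc : T.IsCycleOn (Finset.univ : Finset X) :=
    ⟨by simp, fun x _ y _ => hT x y⟩
  have hn' : (Finset.univ : Finset X).card = n := by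
    rw [Finset.card_univ, ← Nat.card_eq_fintype_card, hcard]
  have hSn : ∀ p, (S ^ n) p = (p.1, p.2 + (Nat.card A : ZMod 2)) := by
    intro p
    rw [skew_product_pow_apply T _ S hS, ← hn', hcyc.pow_card_apply (Finset.mem_univ _),
      hcyc.sum_range_card (Finset.mem_univ _)]
    simp [Set.indicator_apply, Finset.sum_boole, Fintype.card_subtype]
  have hfst := skew_product_zpow_apply_fst T _ S hS
  have hlift : ∀ p y, ∃ t, S.SameCycle p (y, t) := by
    intro p y
    obtain ⟨k, rfl⟩ := hT p.1 y
    exact ⟨((S ^ k) p).2, k, by rw [← hfst]⟩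
  have heven : Even (Nat.card A) →
      Nat.card (Quotient (Equiv.Perm.SameCycle.setoid S)) = 2 ∧
        ∀ p : X × ZMod 2, Nat.card {q : X × ZMod 2 | S.SameCycle p q} = n := by
    intro hA
    have hS1 : S ^ n = 1 := by
      ext1 p
      rw [hSn, (ZMod.natCast_eq_zero_iff_even).2 hA, add_zero]
      rfl
    have hinj : ∀ x s t, S.SameCycle (x, s) (x, t) → s = t := by
      rintro x s t ⟨k, hk⟩
      have hTk : (T ^ k) x = x := by rw [← hfst k (x, s), hk]
      obtain ⟨m, rfl⟩ := (hcyc.zpow_apply_eq (Finset.mem_univ x)).1 hTk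
      rw [hn', zpow_mul, zpow_natCast, hS1, one_zpow] at hk
      exact congrArg Prod.snd hk
    constructor
    · obtain ⟨x⟩ := hX
      refine Eq.trans (Eq.symm <| Nat.card_eq_of_bijective
        (fun s => Quotient.mk (Equiv.Perm.SameCycle.setoid S) (x, s)) ⟨?_, ?_⟩)
        (Nat.card_zmod 2)
      · exact fun s t hst => hinj x s t (Quotient.exact hst)
      · intro q
        induction q using Quotient.inductionOn with
        | _ p =>
          obtain ⟨t, ht⟩ := hlift p x
          exact ⟨t, Quotient.sound ht.symm⟩
    · intro p
      rw [← hcard]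
      refine Nat.card_eq_of_bijective (fun q => q.1.1) ⟨?_, ?_⟩
      · rintro ⟨⟨x, s⟩, hs⟩ ⟨⟨y, t⟩, ht⟩ (rfl : x = y)
        obtain rfl := hinj x s t (Equiv.Perm.SameCycle.trans (Equiv.Perm.SameCycle.symm hs) ht)
        rfl
      · intro y
        obtain ⟨t, ht⟩ := hlift p y
        exact ⟨⟨(y, t), ht⟩, rfl⟩
  refine ⟨⟨fun ⟨_, h⟩ => ?_, fun hA => ?_⟩, heven⟩
  · by_contra hA
    obtain ⟨x⟩ := hX
    have h₁ := h (x, 0)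
    have h₂ := (heven (Nat.not_odd_iff_even.1 hA)).2 (x, 0)
    omega
  · have hall : ∀ p q, S.SameCycle p q := by
      rintro p ⟨y, t⟩
      obtain ⟨s, hs⟩ := hlift p y
      by_cases hst : s = t
      · exact hst ▸ hs
      · refine hs.trans ⟨n, ?_⟩
        rw [zpow_natCast, hSn, (ZMod.natCast_eq_one_iff_odd).2 hA]
        have : s + 1 = t := (by decide : ∀ s t : ZMod 2, s ≠ t → s + 1 = t) s t hst
        rw [this]
    refine ⟨hall, fun p => ?_⟩
    have : {q | S.SameCycle p q} = Set.univ := Set.eq_univ_of_forall (hall p)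
    rw [this, Nat.card_univ, Nat.card_prod, hcard, Nat.card_zmod, mul_comm]
end
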